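/- Under Assumptions 1–5, let z̲ ∈ 𝒰̄ \ {z̲₁, …, z̲_K}. Then there exist a radius ρ > 0 and constants C > 0, c > 0 such that every z ∈ B_ρ(z̲) lies outside the spectrum of ℒ and the spatial Green's function satisfies |G_z(j)| ≤ C exp(−c |j|) for all j ∈ ℤ. -/

import Mathlib

open scoped Classical
open Complex Filter Asymptotics Metric

noncomputable section

set_option autoImplicit false

/-- the space `ℓ²(ℤ;ℂ)` -/
abbrev Seq2 : Type := lp (fun _ : ℤ => ℂ) 2

/-- the action of the convolution operator with coefficients `a` supported in `{-r, …, p}`: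
`(Q u)_j = ∑_{ℓ=-r}^p a_ℓ u_{j+ℓ}`. -/
def convAct (r p : ℕ) (a : ℤ → ℂ) (u : ℤ → ℂ) (j : ℤ) : ℂ :=
  ∑ ℓ ∈ Finset.Icc (-(r : ℤ)) (p : ℤ), a ℓ * u (j + ℓ)

/-- the symbol `Q̂(κ) = ∑_{ℓ=-r}^p a_ℓ κ^ℓ`. -/
def symbol (r p : ℕ) (a : ℤ → ℂ) (κ : ℂ) : ℂ :=
  ∑ ℓ ∈ Finset.Icc (-(r : ℤ)) (p : ℤ), a ℓ * κ ^ ℓ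

/-- the symbol `F = Q̂₀ / Q̂₁` of the operator `ℒ = Q₁⁻¹ Q₀`. -/
def Fsym (r p : ℕ) (a0 a1 : ℤ → ℂ) (κ : ℂ) : ℂ :=
  symbol r p a0 κ / symbol r p a1 κ

/-- `𝔸_ℓ(z) = z a_{ℓ,1} - a_{ℓ,0}`. -/
def Acoef (a0 a1 : ℤ → ℂ) (ℓ : ℤ) (z : ℂ) : ℂ := z * a1 ℓ - a0 ℓ

/-- the companion-type matrix `𝕄(z) ∈ M_{p+r}(ℂ)`: first row
`(-𝔸_{p-1}(z)/𝔸_p(z), …, -𝔸_{-r}(z)/𝔸_p(z))`, ones on the subdiagonal, zeros elsewhere. -/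
def Mmat (r p : ℕ) (a0 a1 : ℤ → ℂ) (z : ℂ) : Matrix (Fin (p + r)) (Fin (p + r)) ℂ :=
  fun i j =>
    if (i : ℕ) = 0 then - Acoef a0 a1 ((p : ℤ) - 1 - (j : ℕ)) z / Acoef a0 a1 (p : ℤ) z
    else if (i : ℕ) = (j : ℕ) + 1 then 1 else 0

/-- the discrete Dirac mass `δ ∈ ℓ²(ℤ;ℂ)`. -/
def dirac : Seq2 := lp.single 2 (0 : ℤ) (1 : ℂ)

/-- The full set of data and assumptions (Assumptions 1–5) of the paper. -/
structure Setup where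
  r : ℕ
  p : ℕ
  hrp : 1 ≤ p + r
  a0 : ℤ → ℂ
  a1 : ℤ → ℂ
  K : ℕ
  hK : 1 ≤ K
  /-- the tangency points `κ̲₁, …, κ̲_K` on the unit circle -/
  kap : Fin K → ℂ
  /-- the drifts `α_k` -/
  α : Fin K → ℝ
  /-- the diffusion coefficients `β_k` -/
  β : Fin K → ℝ
  /-- the integers `μ_k` (the order of tangency is `2 μ_k`) -/
  μ : Fin K → ℕ
  /-- the operator `ℒ = Q₁⁻¹ Q₀` acting on `ℓ²(ℤ;ℂ)` -/
  L : Seq2 →L[ℂ] Seq2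
  /-- Assumption 1: the symbol of `Q₁` does not vanish on the unit circle -/
  hQ1_ne : ∀ κ : ℂ, ‖κ‖ = 1 → symbol r p a1 κ ≠ 0
  /-- Assumption 1: the index condition -/
  hQ1_index :
    (2 * (Real.pi : ℂ) * Complex.I)⁻¹ *
      (∮ κ in C(0, 1), deriv (symbol r p a1) κ / symbol r p a1 κ) = 0
  /-- `ℒ` is characterized by `Q₁ ∘ ℒ = Q₀` -/
  hL : ∀ (u : Seq2) (j : ℤ),
    convAct r p a1 (fun i => L u i) j = convAct r p a0 (fun i => u i) j
  /-- Assumption 2: the `κ̲_k` are distinct points of the unit circle -/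
  hkap_unit : ∀ k, ‖kap k‖ = 1
  hkap_inj : Function.Injective kap
  /-- Assumption 2: `|F| < 1` away from the `κ̲_k` -/
  hF_lt : ∀ κ : ℂ, ‖κ‖ = 1 → (∀ k, κ ≠ kap k) → ‖Fsym r p a0 a1 κ‖ < 1
  /-- Assumption 2: `F(κ̲_k) ∈ 𝕊¹` -/
  hF_unit : ∀ k, ‖Fsym r p a0 a1 (kap k)‖ = 1
  hα : ∀ k, α k ≠ 0
  hβ : ∀ k, 0 < β k
  hμ : ∀ k, 1 ≤ μ k
  /-- Assumption 2: local expansion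
  `F(κ̲_k e^{iξ})/F(κ̲_k) = exp(-i α_k ξ - β_k ξ^{2μ_k} + O(ξ^{2μ_k+1}))` as `ξ → 0` -/
  hexp : ∀ k, ∃ g : ℝ → ℂ,
    (g =O[nhds 0] fun ξ : ℝ => ξ ^ (2 * μ k + 1)) ∧
    ∀ᶠ ξ : ℝ in nhds 0,
      Fsym r p a0 a1 (kap k * Complex.exp (Complex.I * ξ)) / Fsym r p a0 a1 (kap k)
        = Complex.exp (-(Complex.I) * (α k : ℂ) * (ξ : ℂ)
            - (β k : ℂ) * (ξ : ℂ) ^ (2 * μ k) + g ξ)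
  /-- Assumption 3: `𝔸_{-r}` and `𝔸_p` do not vanish on `𝒰̄` -/
  hA : ∀ z : ℂ, 1 ≤ ‖z‖ → Acoef a0 a1 (-(r : ℤ)) z ≠ 0 ∧ Acoef a0 a1 (p : ℤ) z ≠ 0
  /-- Assumption 4: either `Q₁` is the identity, or `a_{-r,1} ≠ 0` and `a_{p,1} ≠ 0` -/
  hQ1' : (∀ ℓ ∈ Finset.Icc (-(r : ℤ)) (p : ℤ), a1 ℓ = if ℓ = 0 then 1 else 0) ∨
    (a1 (-(r : ℤ)) ≠ 0 ∧ a1 (p : ℤ) ≠ 0)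
  /-- Assumption 5: each `ℐ_k` has one or two elements -/
  h5card : ∀ k : Fin K,
    (Finset.univ.filter fun ν =>
      Fsym r p a0 a1 (kap ν) = Fsym r p a0 a1 (kap k)).card ≤ 2
  /-- Assumption 5: when `ℐ_k` has two elements, the corresponding drifts have opposite signs -/
  h5sign : ∀ k ν₁ ν₂ : Fin K,
    Fsym r p a0 a1 (kap ν₁) = Fsym r p a0 a1 (kap k) →
    Fsym r p a0 a1 (kap ν₂) = Fsym r p a0 a1 (kap k) →
    ν₁ ≠ ν₂ → α ν₁ * α ν₂ < 0

/-- the symbol `F` of `ℒ` -/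
def Setup.F (S : Setup) : ℂ → ℂ := Fsym S.r S.p S.a0 S.a1

/-- the tangency points `z̲_k = F(κ̲_k)` of the spectrum of `ℒ` with the unit circle -/
def Setup.zK (S : Setup) (k : Fin S.K) : ℂ := S.F (S.kap k)

/-- the matrix `𝕄(z)` -/
def Setup.M (S : Setup) (z : ℂ) : Matrix (Fin (S.p + S.r)) (Fin (S.p + S.r)) ℂ :=
  Mmat S.r S.p S.a0 S.a1 z

/-! ### Helper material for the proof -/

/-- Memberships in `ℓ²` are stable under translation. -/
theorem memlp_shift (n : ℤ) (u : Seq2) :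
    Memℓp (E := fun _ : ℤ => ℂ) (fun j : ℤ => (u : ℤ → ℂ) (j + n)) 2 := by
  have h := lp.memℓp u
  rw [memℓp_gen_iff (by simp)] at h ⊢
  exact (Equiv.addRight n).summable_iff.2 h

/-- translation by `n` on `ℓ²`. -/
def shiftFun (n : ℤ) (u : Seq2) : Seq2 := ⟨fun j => (u : ℤ → ℂ) (j + n), memlp_shift n u⟩

theorem shiftFun_apply (n : ℤ) (u : Seq2) (j : ℤ) : shiftFun n u j = u (j + n) := rfl

/-- the unit translation as a linear isometric equivalence. -/
def shiftE : Seq2 ≃ₗᵢ[ℂ] Seq2 where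
  toFun := shiftFun 1
  invFun := shiftFun (-1)
  left_inv u := by
    ext j
    simp [shiftFun_apply]
  right_inv u := by
    ext j
    simp [shiftFun_apply]
  map_add' u v := by
    ext j
    rfl
  map_smul' c u := by
    ext j
    rfl
  norm_map' u := by
    have h2 : 0 < (2 : ENNReal).toReal := by simp
    change ‖shiftFun 1 u‖ = ‖u‖
    rw [lp.norm_eq_tsum_rpow h2, lp.norm_eq_tsum_rpow h2]
    congr 1
    exact (Equiv.addRight (1 : ℤ)).tsum_eq (fun j => ‖u j‖ ^ (2 : ENNReal).toReal)

/-- the unit translation as a bounded operator. -/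
def shiftT : Seq2 →L[ℂ] Seq2 := (Unitary.linearIsometryEquiv.symm shiftE : Seq2 →L[ℂ] Seq2)

theorem shiftT_apply (u : Seq2) (j : ℤ) : shiftT u j = u (j + 1) := rfl

theorem shiftT_pow_apply (n : ℕ) (u : Seq2) (j : ℤ) : (shiftT ^ n) u j = u (j + n) := by
  induction n generalizing j with
  | zero => simp
  | succ n ih =>
    rw [pow_succ', mul_apply_eq_comp, shiftT_apply, ih,
      show j + 1 + (n : ℤ) = j + ((n + 1 : ℕ) : ℤ) by push_cast; ring]

theorem shiftT_spectrum (κ : ℂ) (h : κ ∈ spectrum ℂ shiftT) : ‖κ‖ = 1 := by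
  have hu : shiftT ∈ unitary (Seq2 →L[ℂ] Seq2) :=
    (Unitary.linearIsometryEquiv.symm shiftE).2
  have := spectrum.subset_circle_of_unitary hu h
  simpa using this

/-- the polynomial `κ^r * symbol`. -/
def symPoly (r p : ℕ) (a : ℤ → ℂ) : Polynomial ℂ :=
  ∑ ℓ ∈ Finset.Icc (-(r : ℤ)) (p : ℤ), Polynomial.C (a ℓ) * Polynomial.X ^ (ℓ + r).toNat

theorem symPoly_eval (r p : ℕ) (a : ℤ → ℂ) (κ : ℂ) (hκ : κ ≠ 0) :
    (symPoly r p a).eval κ = κ ^ r * symbol r p a κ := by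
  unfold symPoly symbol
  rw [Polynomial.eval_finsetSum, Finset.mul_sum]
  refine Finset.sum_congr rfl fun ℓ hℓ => ?_
  rw [Finset.mem_Icc] at hℓ
  have : ((ℓ + r).toNat : ℤ) = ℓ + r := Int.toNat_of_nonneg (by linarith)
  simp only [Polynomial.eval_mul, Polynomial.eval_C, Polynomial.eval_pow, Polynomial.eval_X]
  rw [← zpow_natCast, this, zpow_add₀ hκ, zpow_natCast]
  ring

/-- the bounded operator given by the (translated) convolution. -/
def Qop (r p : ℕ) (a : ℤ → ℂ) : Seq2 →L[ℂ] Seq2 := Polynomial.aeval shiftT (symPoly r p a)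

theorem Qop_eq (r p : ℕ) (a : ℤ → ℂ) : Qop r p a =
    ∑ ℓ ∈ Finset.Icc (-(r : ℤ)) (p : ℤ), a ℓ • shiftT ^ (ℓ + r).toNat := by
  unfold Qop symPoly
  rw [map_sum]
  refine Finset.sum_congr rfl fun ℓ _ => ?_
  simp [Algebra.smul_def]

theorem Qop_apply (r p : ℕ) (a : ℤ → ℂ) (u : Seq2) (j : ℤ) :
    Qop r p a u j = convAct r p a (fun i => u i) (j + r) := by
  rw [Qop_eq]
  unfold convAct
  simp only [ContinuousLinearMap.sum_apply, lp.coeFn_sum, Finset.sum_apply,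
    ContinuousLinearMap.smul_apply, lp.coeFn_smul, Pi.smul_apply, smul_eq_mul]
  refine Finset.sum_congr rfl fun ℓ hℓ => ?_
  rw [Finset.mem_Icc] at hℓ
  have : ((ℓ + r).toNat : ℤ) = ℓ + r := Int.toNat_of_nonneg (by linarith)
  rw [shiftT_pow_apply, this, show j + (ℓ + (r : ℤ)) = j + r + ℓ by ring]

theorem dirac_apply (j : ℤ) : dirac j = if j = 0 then 1 else 0 := by
  unfold dirac
  rw [lp.single_apply]
  simp [Pi.single_apply]

theorem dirac_ne : dirac ≠ 0 := by
  intro h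
  have := dirac_apply 0
  rw [h] at this
  simp at this

instance seq2_nontrivial : Nontrivial Seq2 := ⟨⟨dirac, 0, dirac_ne⟩⟩

theorem Qop_isUnit (r p : ℕ) (a : ℤ → ℂ) (h : ∀ κ : ℂ, ‖κ‖ = 1 → symbol r p a κ ≠ 0) :
    IsUnit (Qop r p a) := by
  by_contra hn
  rw [← spectrum.zero_mem_iff ℂ] at hn
  unfold Qop at hn
  rw [spectrum.map_polynomial_aeval] at hn
  obtain ⟨κ, hκ, h0⟩ := hn
  have h1 := shiftT_spectrum κ hκ
  have hk : κ ≠ 0 := by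
    rintro rfl
    simp at h1
  simp only [symPoly_eval r p a κ hk] at h0
  exact mul_ne_zero (pow_ne_zero _ hk) (h κ h1) h0

theorem symbol_Acoef (r p : ℕ) (a0 a1 : ℤ → ℂ) (z κ : ℂ) :
    symbol r p (fun ℓ => Acoef a0 a1 ℓ z) κ = z * symbol r p a1 κ - symbol r p a0 κ := by
  unfold symbol Acoef
  rw [Finset.mul_sum, ← Finset.sum_sub_distrib]
  refine Finset.sum_congr rfl fun ℓ _ => ?_
  ring

theorem Qop_Acoef (S : Setup) (z : ℂ) :
    Qop S.r S.p (fun ℓ => Acoef S.a0 S.a1 ℓ z) =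
      Qop S.r S.p S.a1 * (algebraMap ℂ (Seq2 →L[ℂ] Seq2) z - S.L) := by
  have h1 : Qop S.r S.p S.a1 * S.L = Qop S.r S.p S.a0 := by
    ext u j
    rw [mul_apply_eq_comp, Qop_apply, Qop_apply, S.hL]
  rw [mul_sub, h1, Qop_eq, Qop_eq, Qop_eq, Finset.sum_mul, ← Finset.sum_sub_distrib]
  refine Finset.sum_congr rfl fun ℓ _ => ?_
  unfold Acoef
  rw [← Algebra.commutes, ← Algebra.smul_def, smul_smul, sub_smul]

theorem symbol_differentiableAt (r p : ℕ) (a : ℤ → ℂ) (κ : ℂ) (hκ : κ ≠ 0) :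
    DifferentiableAt ℂ (symbol r p a) κ := by
  unfold symbol
  refine DifferentiableAt.fun_sum fun ℓ _ => ?_
  exact (differentiableAt_zpow.2 (Or.inl hκ)).const_mul _

theorem symbol_continuousOn (r p : ℕ) (a : ℤ → ℂ) :
    ContinuousOn (symbol r p a) {κ | κ ≠ 0} := fun κ hκ =>
  (symbol_differentiableAt r p a κ hκ).continuousAt.continuousWithinAt

/-- the symbol of `zQ₁ - Q₀` does not vanish on the unit circle at `z₀`. -/
theorem symbol_ne (S : Setup) (z₀ : ℂ) (hz : 1 ≤ ‖z₀‖) (hzk : ∀ k, z₀ ≠ S.zK k) (κ : ℂ)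
    (hκ : ‖κ‖ = 1) : z₀ * symbol S.r S.p S.a1 κ - symbol S.r S.p S.a0 κ ≠ 0 := by
  intro h
  have h1 := S.hQ1_ne κ hκ
  have hF : z₀ = Fsym S.r S.p S.a0 S.a1 κ := by
    unfold Fsym
    rw [eq_div_iff h1]
    exact sub_eq_zero.1 h
  by_cases hk : ∀ k, κ ≠ S.kap k
  · have := S.hF_lt κ hκ hk
    rw [← hF] at this
    linarith
  · push Not at hk
    obtain ⟨k, rfl⟩ := hk
    exact hzk k hF

/-- the contour-integral formula for the Green's function. -/
def greenFun (r p : ℕ) (a1 b : ℤ → ℂ) (j : ℤ) : ℂ :=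
  (2 * (Real.pi : ℂ) * Complex.I)⁻¹ •
    ∮ κ in C(0, 1), κ ^ (j - 1) * (symbol r p a1 κ / symbol r p b κ)

theorem zpow_circle (n : ℤ) : (2 * (Real.pi : ℂ) * Complex.I)⁻¹ *
    (∮ κ in C(0, 1), κ ^ n) = if n = -1 then 1 else 0 := by
  split_ifs with h
  · subst h
    have := circleIntegral.integral_sub_center_inv 0 (one_ne_zero (α := ℝ))
    simp only [sub_zero] at this
    simp only [zpow_neg_one, this]
    exact inv_mul_cancel₀ Complex.two_pi_I_ne_zero
  · have := circleIntegral.integral_sub_zpow_of_ne h 0 0 1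
    simp only [sub_zero] at this
    rw [this, mul_zero]

theorem ne_zero_of_sphere {κ : ℂ} (h : κ ∈ sphere (0 : ℂ) 1) : κ ≠ 0 := by
  rintro rfl
  simp at h

theorem greenFun_conv (r p : ℕ) (a1 b : ℤ → ℂ) (hb : ∀ κ : ℂ, ‖κ‖ = 1 → symbol r p b κ ≠ 0)
    (j : ℤ) : convAct r p b (greenFun r p a1 b) j =
      convAct r p a1 (fun i => if i = 0 then 1 else 0) j := by
  have hcz : ∀ n : ℤ, ContinuousOn (fun κ : ℂ => κ ^ n) (sphere (0 : ℂ) 1) := fun n κ hκ =>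
    (continuousAt_zpow₀ κ n (Or.inl (ne_zero_of_sphere hκ))).continuousWithinAt
  have hcs : ∀ a : ℤ → ℂ, ContinuousOn (symbol r p a) (sphere (0 : ℂ) 1) := fun a =>
    (symbol_continuousOn r p a).mono fun κ hκ => ne_zero_of_sphere hκ
  have hcq : ContinuousOn (fun κ => symbol r p a1 κ / symbol r p b κ) (sphere (0 : ℂ) 1) :=
    (hcs a1).div (hcs b) fun κ hκ => hb κ (by simpa using hκ)
  calc convAct r p b (greenFun r p a1 b) j
      = (2 * (Real.pi : ℂ) * Complex.I)⁻¹ *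
        ∮ κ in C(0, 1), ∑ ℓ ∈ Finset.Icc (-(r : ℤ)) (p : ℤ),
          b ℓ * (κ ^ (j + ℓ - 1) * (symbol r p a1 κ / symbol r p b κ)) := by
        rw [circleIntegral.integral_fun_sum]
        · unfold convAct greenFun
          rw [Finset.mul_sum]
          refine Finset.sum_congr rfl fun ℓ _ => ?_
          rw [circleIntegral.integral_const_mul, smul_eq_mul]
          ring
        · intro ℓ _
          exact ContinuousOn.circleIntegrable zero_le_one
            (continuousOn_const.mul ((hcz _).mul hcq))
    _ = (2 * (Real.pi : ℂ) * Complex.I)⁻¹ *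
        ∮ κ in C(0, 1), ∑ ℓ ∈ Finset.Icc (-(r : ℤ)) (p : ℤ), a1 ℓ * κ ^ (j + ℓ - 1) := by
        congr 1
        refine circleIntegral.integral_congr zero_le_one fun κ hκ => ?_
        have h0 := ne_zero_of_sphere hκ
        have h1 := hb κ (by simpa using hκ)
        have e : ∀ ℓ : ℤ, κ ^ (j + ℓ - 1) = κ ^ (j - 1) * κ ^ ℓ := fun ℓ => by
          rw [← zpow_add₀ h0]
          congr 1
          ring
        simp only [e]
        have e2 : ∀ a : ℤ → ℂ, ∀ w : ℂ, ∑ ℓ ∈ Finset.Icc (-(r : ℤ)) (p : ℤ),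
            a ℓ * (κ ^ (j - 1) * κ ^ ℓ * w) = κ ^ (j - 1) * w * symbol r p a κ := fun a w => by
          unfold symbol
          rw [Finset.mul_sum]
          refine Finset.sum_congr rfl fun ℓ _ => ?_
          ring
        have e3 := e2 a1 1
        simp only [mul_one] at e3
        rw [e2, e3]
        field_simp
    _ = convAct r p a1 (fun i => if i = 0 then 1 else 0) j := by
        rw [circleIntegral.integral_fun_sum]
        · unfold convAct
          rw [Finset.mul_sum]
          refine Finset.sum_congr rfl fun ℓ _ => ?_
          rw [circleIntegral.integral_const_mul, mul_left_comm, zpow_circle]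
          congr 1
          refine if_congr ?_ rfl rfl
          constructor <;> intro h <;> linarith
        · intro ℓ _
          exact ContinuousOn.circleIntegrable zero_le_one
            (continuousOn_const.mul (hcz _))

/-- exponential bound by shifting the contour. -/
theorem greenFun_bound (r p : ℕ) (a1 b : ℤ → ℂ) (c M : ℝ) (hc : 0 < c)
    (hb : ∀ κ : ℂ, Real.exp (-c) ≤ ‖κ‖ → ‖κ‖ ≤ Real.exp c → symbol r p b κ ≠ 0)
    (hM : ∀ κ : ℂ, Real.exp (-c) ≤ ‖κ‖ → ‖κ‖ ≤ Real.exp c →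
      ‖symbol r p a1 κ / symbol r p b κ‖ ≤ M) (j : ℤ) :
    ‖greenFun r p a1 b j‖ ≤ M * Real.exp (-c * |(j : ℝ)|) := by
  have hd : ∀ κ : ℂ, Real.exp (-c) ≤ ‖κ‖ → ‖κ‖ ≤ Real.exp c → DifferentiableAt ℂ
      (fun κ => κ ^ (j - 1) * (symbol r p a1 κ / symbol r p b κ)) κ := fun κ h1 h2 => by
    have h0 : κ ≠ 0 := by
      rintro rfl
      have := Real.exp_pos (-c)
      simp at h1
      linarith
    exact (differentiableAt_zpow.2 (Or.inl h0)).mul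
      ((symbol_differentiableAt _ _ _ _ h0).div (symbol_differentiableAt _ _ _ _ h0) (hb κ h1 h2))
  have key : ∀ t : ℝ, -c ≤ t → t ≤ c →
      ‖(2 * (Real.pi : ℂ) * Complex.I)⁻¹ • ∮ κ in C(0, Real.exp t),
        κ ^ (j - 1) * (symbol r p a1 κ / symbol r p b κ)‖ ≤ M * Real.exp (t * j) := by
    intro t ht1 ht2
    have := circleIntegral.norm_two_pi_i_inv_smul_integral_le_of_norm_le_const
      (c := 0) (R := Real.exp t) (C := Real.exp (t * (j - 1)) * M)
      (f := fun κ => κ ^ (j - 1) * (symbol r p a1 κ / symbol r p b κ)) (Real.exp_pos t).le ?_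
    · refine this.trans (le_of_eq ?_)
      rw [← mul_assoc, ← Real.exp_add, mul_comm]
      congr 2
      ring
    · intro κ hκ
      have hκ' : ‖κ‖ = Real.exp t := by simpa using hκ
      rw [norm_mul, norm_zpow, hκ']
      have e : Real.exp t ^ (j - 1) = Real.exp (t * (j - 1)) := by
        rw [← Real.rpow_intCast, ← Real.exp_mul]
        push_cast
        rfl
      rw [e]
      refine mul_le_mul_of_nonneg_left (hM κ ?_ ?_) (Real.exp_pos _).le
      · rw [hκ']
        exact Real.exp_le_exp.2 ht1
      · rw [hκ']
        exact Real.exp_le_exp.2 ht2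
  have shift : ∀ s t : ℝ, -c ≤ s → s ≤ t → t ≤ c →
      (∮ κ in C(0, Real.exp t), κ ^ (j - 1) * (symbol r p a1 κ / symbol r p b κ)) =
      ∮ κ in C(0, Real.exp s), κ ^ (j - 1) * (symbol r p a1 κ / symbol r p b κ) := by
    intro s t hs hst ht
    have e1 := Real.exp_le_exp.2 hs
    have e2 := Real.exp_le_exp.2 ht
    refine Complex.circleIntegral_eq_of_differentiable_on_annulus_off_countable
      (Real.exp_pos s) (Real.exp_le_exp.2 hst) Set.countable_empty ?_ ?_
    · intro κ hκ
      simp only [Set.mem_sdiff, mem_closedBall, mem_ball, dist_zero_right, not_lt] at hκ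
      exact (hd κ (by linarith [hκ.2]) (by linarith [hκ.1])).continuousAt.continuousWithinAt
    · intro κ hκ
      simp only [Set.mem_sdiff, mem_closedBall, mem_ball, dist_zero_right, not_le] at hκ
      exact hd κ (by linarith [hκ.1.2]) (by linarith [hκ.1.1])
  unfold greenFun
  rcases le_total 0 j with hj | hj
  · have := shift (-c) 0 le_rfl (by linarith) hc.le
    rw [Real.exp_zero] at this
    rw [this]
    have hj' : (0 : ℝ) ≤ j := by exact_mod_cast hj
    rw [abs_of_nonneg hj']
    exact key (-c) le_rfl (by linarith)
  · have := shift 0 c (by linarith) hc.le le_rfl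
    rw [Real.exp_zero] at this
    rw [← this]
    have hj' : (j : ℝ) ≤ 0 := by exact_mod_cast hj
    rw [abs_of_nonpos hj', neg_mul_neg]
    exact key c (by linarith) le_rfl

theorem memlp_of_exp (g : ℤ → ℂ) (C c : ℝ) (hc : 0 < c)
    (h : ∀ j : ℤ, ‖g j‖ ≤ C * Real.exp (-c * |(j : ℝ)|)) :
    Memℓp (E := fun _ : ℤ => ℂ) g 2 := by
  rw [memℓp_gen_iff (by simp)]
  have hs : Summable fun j : ℤ => C ^ 2 * Real.exp (-(2 * c) * |(j : ℝ)|) := by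
    refine Summable.mul_left _ ?_
    have hN : Summable fun n : ℕ => Real.exp (-(2 * c) * |((n : ℤ) : ℝ)|) := by
      have := summable_geometric_of_lt_one (Real.exp_pos (-(2 * c))).le
        (by rw [Real.exp_lt_one_iff]; linarith)
      refine this.congr fun n => ?_
      rw [← Real.exp_nat_mul]
      congr 1
      simp [mul_comm]
    refine Summable.of_nat_of_neg hN ?_
    simpa using hN
  refine Summable.of_nonneg_of_le (fun j => by positivity) (fun j => ?_) hs
  have e : (2 : ENNReal).toReal = ((2 : ℕ) : ℝ) := by simp
  rw [e, Real.rpow_natCast]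
  refine (pow_le_pow_left₀ (norm_nonneg _) (h j) 2).trans (le_of_eq ?_)
  rw [mul_pow, ← Real.exp_nat_mul]
  congr 2
  push_cast
  ring

/-- uniform nonvanishing and bounds on an annulus. -/
theorem exists_annulus (S : Setup) (z₀ : ℂ) (hz : 1 ≤ ‖z₀‖) (hzk : ∀ k, z₀ ≠ S.zK k) :
    ∃ ρ > (0 : ℝ), ∃ c > (0 : ℝ), ∃ M > (0 : ℝ), ∀ z ∈ ball z₀ ρ, ∀ κ : ℂ,
      Real.exp (-c) ≤ ‖κ‖ → ‖κ‖ ≤ Real.exp c →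
      symbol S.r S.p (fun ℓ => Acoef S.a0 S.a1 ℓ z) κ ≠ 0 ∧
      ‖symbol S.r S.p S.a1 κ / symbol S.r S.p (fun ℓ => Acoef S.a0 S.a1 ℓ z) κ‖ ≤ M := by
  simp only [symbol_Acoef]
  set P : ℂ × ℂ → ℂ := fun w => w.1 * symbol S.r S.p S.a1 w.2 - symbol S.r S.p S.a0 w.2 with hP
  have ho : IsOpen {w : ℂ × ℂ | w.2 ≠ 0} := isOpen_ne.preimage continuous_snd
  have hsc : ∀ a : ℤ → ℂ, ContinuousOn (fun w : ℂ × ℂ => symbol S.r S.p a w.2)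
      {w : ℂ × ℂ | w.2 ≠ 0} := fun a =>
    (symbol_continuousOn S.r S.p a).comp continuousOn_snd fun w hw => hw
  have hPc : ContinuousOn P {w : ℂ × ℂ | w.2 ≠ 0} :=
    (continuousOn_fst.mul (hsc S.a1)).sub (hsc S.a0)
  have hUo : IsOpen ({w : ℂ × ℂ | w.2 ≠ 0} ∩ P ⁻¹' {x | x ≠ 0}) :=
    hPc.isOpen_inter_preimage ho isOpen_ne
  obtain ⟨u, v, hu, hv, hzu, hsv, huv⟩ := generalized_tube_lemma (isCompact_singleton (x := z₀))
    (isCompact_sphere (0 : ℂ) 1) hUo (by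
      rintro ⟨z, κ⟩ ⟨h1, h2⟩
      simp only [Set.mem_singleton_iff] at h1
      subst h1
      exact ⟨ne_zero_of_sphere h2, symbol_ne S z hz hzk κ (by simpa using h2)⟩)
  obtain ⟨δ, hδ, hδv⟩ := (isCompact_sphere (0 : ℂ) 1).exists_cthickening_subset_open hv hsv
  obtain ⟨ρ, hρ, hρu⟩ := nhds_basis_closedBall.mem_iff.1 (hu.mem_nhds (hzu rfl))
  set c := Real.log (1 + δ) with hcdef
  have hc : 0 < c := Real.log_pos (by linarith)
  have hec : Real.exp c = 1 + δ := Real.exp_log (by linarith)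
  have hec' : 1 - δ ≤ Real.exp (-c) := by
    rw [Real.exp_neg, hec, ← one_div, le_div_iff₀ (by linarith)]
    nlinarith
  have hann : closedBall (0 : ℂ) (Real.exp c) \ ball 0 (Real.exp (-c)) ⊆ v := by
    intro κ hκ
    simp only [Set.mem_sdiff, mem_closedBall, mem_ball, dist_zero_right, not_lt] at hκ
    apply hδv
    have hpos : 0 < ‖κ‖ := lt_of_lt_of_le (Real.exp_pos _) hκ.2
    have hk : κ ≠ 0 := norm_pos_iff.1 hpos
    refine mem_cthickening_of_dist_le κ (κ / (‖κ‖ : ℂ)) δ _ ?_ ?_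
    · simp [hk]
    · have e : κ - κ / (‖κ‖ : ℂ) = κ / (‖κ‖ : ℂ) * ((‖κ‖ - 1 : ℝ) : ℂ) := by
        have : (‖κ‖ : ℂ) ≠ 0 := by exact_mod_cast hpos.ne'
        push_cast
        field_simp
      rw [dist_eq_norm, e, norm_mul, norm_div, Complex.norm_real, Complex.norm_real, norm_norm,
        div_self hpos.ne', one_mul, Real.norm_eq_abs, abs_le]
      constructor <;> linarith [hκ.1, hκ.2]
  have hKc : IsCompact (closedBall z₀ ρ ×ˢ
      (closedBall (0 : ℂ) (Real.exp c) \ ball 0 (Real.exp (-c)))) :=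
    (isCompact_closedBall z₀ ρ).prod ((isCompact_closedBall _ _).diff isOpen_ball)
  have hKU := (Set.prod_mono hρu hann).trans huv
  have hcont : ContinuousOn (fun w : ℂ × ℂ => symbol S.r S.p S.a1 w.2 / P w) (closedBall z₀ ρ ×ˢ
      (closedBall (0 : ℂ) (Real.exp c) \ ball 0 (Real.exp (-c)))) :=
    ((hsc S.a1).mono fun w hw => (hKU hw).1).div (hPc.mono fun w hw => (hKU hw).1)
      fun w hw => (hKU hw).2
  obtain ⟨M, hM⟩ := hKc.exists_bound_of_continuousOn hcont
  refine ⟨ρ, hρ, c, hc, max M 1, lt_max_of_lt_right one_pos, fun z hzb κ h1 h2 => ?_⟩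
  have hmem : (z, κ) ∈ closedBall z₀ ρ ×ˢ
      (closedBall (0 : ℂ) (Real.exp c) \ ball 0 (Real.exp (-c))) := by
    refine ⟨ball_subset_closedBall hzb, ?_⟩
    simpa using ⟨h2, h1⟩
  exact ⟨(hKU hmem).2, (hM _ hmem).trans (le_max_left _ _)⟩

/-- Lemma 2 (bounds away from the tangency points): for `z̲ ∈ 𝒰̄ \ {z̲₁,…,z̲_K}`, there is a
ball `B_ρ(z̲)` on which every `z` is in the resolvent set of `ℒ` and the spatial Green's function
`G_z`, i.e. the solution of `(z I - ℒ) G_z = δ`, decays exponentially in `j`, uniformly in `z`. -/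
theorem green_bound_away_from_tangency (S : Setup) (z₀ : ℂ) (hz : 1 ≤ ‖z₀‖)
    (hzk : ∀ k, z₀ ≠ S.zK k) :
    ∃ ρ > (0 : ℝ), ∃ C > (0 : ℝ), ∃ c > (0 : ℝ), ∀ z ∈ ball z₀ ρ,
      z ∉ spectrum ℂ S.L ∧
      ∃ G : Seq2, z • G - S.L G = dirac ∧
        ∀ j : ℤ, ‖G j‖ ≤ C * Real.exp (-c * |(j : ℝ)|) := by
  obtain ⟨ρ, hρ, c, hc, M, hM, H⟩ := exists_annulus S z₀ hz hzk
  refine ⟨ρ, hρ, M, hM, c, hc, fun z hzb => ?_⟩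
  have hcirc : ∀ κ : ℂ, ‖κ‖ = 1 → symbol S.r S.p (fun ℓ => Acoef S.a0 S.a1 ℓ z) κ ≠ 0 :=
    fun κ hκ => (H z hzb κ (by rw [hκ]; exact Real.exp_le_one_iff.2 (by linarith))
      (by rw [hκ]; exact Real.one_le_exp hc.le)).1
  have hU1 := Qop_isUnit S.r S.p S.a1 S.hQ1_ne
  have hUz := Qop_isUnit S.r S.p _ hcirc
  have hQ := Qop_Acoef S z
  constructor
  · rw [spectrum.notMem_iff]
    rw [hQ] at hUz
    obtain ⟨q, hq⟩ := hU1
    rw [← hq, Units.isUnit_units_mul] at hUz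
    exact hUz
  · have hbd := greenFun_bound S.r S.p S.a1 (fun ℓ => Acoef S.a0 S.a1 ℓ z) c M hc
      (fun κ h1 h2 => (H z hzb κ h1 h2).1) (fun κ h1 h2 => (H z hzb κ h1 h2).2)
    refine ⟨⟨_, memlp_of_exp _ M c hc hbd⟩, ?_, hbd⟩
    set G : Seq2 := ⟨_, memlp_of_exp _ M c hc hbd⟩ with hG
    have h1 : Qop S.r S.p S.a1 (z • G - S.L G) = Qop S.r S.p S.a1 dirac := by
      have e : Qop S.r S.p S.a1 (z • G - S.L G) =
          Qop S.r S.p (fun ℓ => Acoef S.a0 S.a1 ℓ z) G := by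
        rw [hQ, mul_apply_eq_comp]
        rfl
      rw [e]
      ext j
      rw [Qop_apply, Qop_apply]
      simp only [dirac_apply]
      exact greenFun_conv S.r S.p S.a1 _ hcirc (j + S.r)
    obtain ⟨q, hq⟩ := hU1
    rw [← hq] at h1
    have h2 := congrArg (fun x => (↑q⁻¹ : Seq2 →L[ℂ] Seq2) x) h1
    simpa [← mul_apply_eq_comp, -map_sub] using h2
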